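/- Let U : ℝ → Matrix (Fin d) (Fin d) ℂ be a differentiable family of unitary matrices, let ρ_i = Σ_{n=1}^{r} q_n |φ_n⟩⟨φ_n| with φ_1,…,φ_r orthonormal, q_n > 0, Σ_n q_n = 1, and set ρ(x) = U(x) ρ_i U(x)† and H(x) = i · U'(x)† U(x) (a Hermitian matrix). Then ρ(x), with eigenvectors φ_n(x) = U(x) φ_n, is quasi-pure at x if and only if for every pair k ≠ l in {1,…,r}, either q_k = q_l or ⟨φ_k, H(x) φ_l⟩ = 0. -/

import Mathlib

open Matrix
open scoped Classical

/-- The rank-one matrix `|v⟩⟨w|`, sending `u` to `⟨w, u⟩ v`. -/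
noncomputable def ketbra {n : Type*} (v w : n → ℂ) : Matrix n n ℂ :=
  Matrix.vecMulVec v (star w)

theorem Matrix.hasDerivAt_mul_apply {l m n : Type*} [Fintype m] {A : ℝ → Matrix l m ℂ}
    {B : ℝ → Matrix m n ℂ} {A' : Matrix l m ℂ} {B' : Matrix m n ℂ} {x : ℝ}
    (hA : ∀ i j, HasDerivAt (fun y => A y i j) (A' i j) x)
    (hB : ∀ i j, HasDerivAt (fun y => B y i j) (B' i j) x) (i : l) (j : n) :
    HasDerivAt (fun y => (A y * B y) i j) ((A' * B x + A x * B') i j) x := by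
  simp only [Matrix.mul_apply, Matrix.add_apply, ← Finset.sum_add_distrib]
  exact HasDerivAt.fun_sum fun k _ => (hA i k).fun_mul (hB k j)

theorem Matrix.hasDerivAt_conjTranspose_apply {m n : Type*} {A : ℝ → Matrix m n ℂ}
    {A' : Matrix m n ℂ} {x : ℝ}
    (hA : ∀ i j, HasDerivAt (fun y => A y i j) (A' i j) x) (i : n) (j : m) :
    HasDerivAt (fun y => (A y)ᴴ i j) (A'ᴴ i j) x := by
  simpa only [Matrix.conjTranspose_apply] using (hA j i).star

theorem ketbra_mulVec {n : Type*} [Fintype n] (v w u : n → ℂ) :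
    ketbra v w *ᵥ u = (star w ⬝ᵥ u) • v := by
  rw [ketbra, Matrix.vecMulVec_mulVec, op_smul_eq_smul]

theorem vecMul_ketbra {n : Type*} [Fintype n] (v w u : n → ℂ) :
    u ᵥ* ketbra v w = (u ⬝ᵥ v) • star w := by
  rw [ketbra, Matrix.vecMul_vecMulVec]

/-- Matrix elements of the commutator of `∑ₙ qₙ|φₙ⟩⟨φₙ|` with `A`, between eigenvectors. -/
theorem dotProduct_commutator_mulVec {n ι : Type*} [Fintype n] [Fintype ι] [DecidableEq ι]
    (q : ι → ℝ) (φ : ι → n → ℂ)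
    (hortho : ∀ i j, star (φ i) ⬝ᵥ φ j = if i = j then 1 else 0)
    (A : Matrix n n ℂ) (k l : ι) :
    star (φ k) ⬝ᵥ (((∑ i, (q i : ℂ) • ketbra (φ i) (φ i)) * A -
        A * ∑ i, (q i : ℂ) • ketbra (φ i) (φ i)) *ᵥ φ l) =
      ((q k : ℂ) - q l) * (star (φ k) ⬝ᵥ (A *ᵥ φ l)) := by
  have hr : (∑ i, (q i : ℂ) • ketbra (φ i) (φ i)) *ᵥ φ l = (q l : ℂ) • φ l := by
    simp [Matrix.sum_mulVec, Matrix.smul_mulVec, ketbra_mulVec, hortho]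
  have hl : star (φ k) ᵥ* (∑ i, (q i : ℂ) • ketbra (φ i) (φ i)) = (q k : ℂ) • star (φ k) := by
    simp [Matrix.vecMul_sum, Matrix.vecMul_smul, vecMul_ketbra, hortho]
  rw [Matrix.sub_mulVec, dotProduct_sub, ← Matrix.mulVec_mulVec, ← Matrix.mulVec_mulVec, hr,
    Matrix.dotProduct_mulVec, hl, Matrix.mulVec_smul, smul_dotProduct, dotProduct_smul,
    smul_eq_mul, smul_eq_mul, sub_mul]

/-- Let `U(x)` be a differentiable family of unitaries,
`ρᵢ = ∑ₙ qₙ|φₙ⟩⟨φₙ|` with `φₙ` orthonormal, `qₙ > 0`, `∑ₙ qₙ = 1`, and set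
`ρ(x) = U(x) ρᵢ U(x)†`, `H(x) = i U'(x)† U(x)`. Then `ρ(x)`, with eigenvectors
`φₙ(x) = U(x) φₙ`, is quasi-pure at `x` if and only if for every pair `k ≠ l`, either
`qₖ = qₗ` or `⟨φₖ, H(x) φₗ⟩ = 0`. -/
theorem unitary_family_quasiPure_iff
    {d r : ℕ}
    (U : ℝ → Matrix (Fin d) (Fin d) ℂ)
    (hU : ∀ x, U x ∈ Matrix.unitaryGroup (Fin d) ℂ)
    (U' : ℝ → Matrix (Fin d) (Fin d) ℂ)
    (hU' : ∀ x i j, HasDerivAt (fun y => U y i j) (U' x i j) x)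
    (q : Fin r → ℝ) (φ : Fin r → Fin d → ℂ)
    (hortho : ∀ m n, star (φ m) ⬝ᵥ φ n = if m = n then 1 else 0)
    (hqpos : ∀ n, 0 < q n) (hqsum : ∑ n, q n = 1)
    (ρi : Matrix (Fin d) (Fin d) ℂ)
    (hρi : ρi = ∑ n, (q n : ℂ) • ketbra (φ n) (φ n))
    (ρ : ℝ → Matrix (Fin d) (Fin d) ℂ)
    (hρ : ∀ x, ρ x = U x * ρi * (U x)ᴴ)
    (H : ℝ → Matrix (Fin d) (Fin d) ℂ)
    (hH : ∀ x, H x = Complex.I • ((U' x)ᴴ * U x))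
    (x : ℝ)
    (ρ' : Matrix (Fin d) (Fin d) ℂ)
    (hρ' : ∀ i j, HasDerivAt (fun y => ρ y i j) (ρ' i j) x) :
    (∀ k l, star (U x *ᵥ φ k) ⬝ᵥ (ρ' *ᵥ (U x *ᵥ φ l)) = 0) ↔
      (∀ k l, k ≠ l → (q k = q l ∨ star (φ k) ⬝ᵥ (H x *ᵥ φ l) = 0)) := by
  have hUx : (U x)ᴴ * U x = 1 := Matrix.mem_unitaryGroup_iff'.mp (hU x)
  have hskew : (U' x)ᴴ * U x + (U x)ᴴ * U' x = 0 := by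
    ext i j
    refine (Matrix.hasDerivAt_mul_apply (Matrix.hasDerivAt_conjTranspose_apply (hU' x))
      (hU' x) i j).unique ?_
    have h1 : ∀ y, (U y)ᴴ * U y = 1 := fun y => Matrix.mem_unitaryGroup_iff'.mp (hU y)
    simp only [h1]
    exact hasDerivAt_const _ _
  have hρ'eq : ρ' = U' x * ρi * (U x)ᴴ + U x * ρi * (U' x)ᴴ := by
    ext i j
    refine (hρ' i j).unique ?_
    simp only [hρ]
    refine Matrix.hasDerivAt_mul_apply (fun a b => ?_)
      (Matrix.hasDerivAt_conjTranspose_apply (hU' x)) i j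
    simpa using Matrix.hasDerivAt_mul_apply (hU' x) (B' := 0)
      (fun a b => hasDerivAt_const x (ρi a b)) a b
  have hcomm : (U x)ᴴ * ρ' * U x = ρi * ((U' x)ᴴ * U x) - (U' x)ᴴ * U x * ρi := by
    calc (U x)ᴴ * ρ' * U x
        = (U x)ᴴ * U' x * ρi * ((U x)ᴴ * U x) + (U x)ᴴ * U x * ρi * ((U' x)ᴴ * U x) := by
          rw [hρ'eq]; noncomm_ring
      _ = ρi * ((U' x)ᴴ * U x) - (U' x)ᴴ * U x * ρi := by
          rw [hUx, eq_neg_of_add_eq_zero_right hskew]; noncomm_ring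
  have hkey : ∀ k l, star (U x *ᵥ φ k) ⬝ᵥ (ρ' *ᵥ (U x *ᵥ φ l)) =
      ((q k : ℂ) - q l) * (star (φ k) ⬝ᵥ (((U' x)ᴴ * U x) *ᵥ φ l)) := by
    intro k l
    rw [← dotProduct_commutator_mulVec q φ hortho, ← hρi, ← hcomm, Matrix.star_mulVec,
      ← Matrix.dotProduct_mulVec, Matrix.mulVec_mulVec, Matrix.mulVec_mulVec, Matrix.mul_assoc]
  simp only [hkey, hH, Matrix.smul_mulVec, dotProduct_smul, smul_eq_zero, Complex.I_ne_zero,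
    false_or, mul_eq_zero, sub_eq_zero, Complex.ofReal_inj]
  refine ⟨fun h k l _ => h k l, fun h k l => ?_⟩
  obtain rfl | hkl := eq_or_ne k l
  · exact Or.inl rfl
  · exact h k l hkl
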